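/- (Gradient norm recursion for the MR scaling.) Let f : ℝ^d → ℝ be twice continuously differentiable and satisfy Hessian directional smoothness with constant L₂ ≥ 0. Fix x with g = g(x) ≠ 0 and H(x) g ≠ 0, and suppose s_MR = ⟨g, H(x) g⟩/‖H(x) g‖² ≥ 0 (nonnegative curvature along g). Then for p = −s_MR g, the next gradient satisfies ‖g(x + p)‖ ≤ (L₂/2)‖p‖² + √(1 − cos²θ) ‖g‖, where cos θ = ⟨g, H(x) g⟩/(‖g‖‖H(x) g‖). -/

import Mathlib

open scoped RealInnerProductSpace

/-- The Hessian of `f` at `x`, as a continuous linear map. -/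
noncomputable def hessian {d : ℕ} (f : EuclideanSpace ℝ (Fin d) → ℝ)
    (x : EuclideanSpace ℝ (Fin d)) :
    EuclideanSpace ℝ (Fin d) →L[ℝ] EuclideanSpace ℝ (Fin d) :=
  fderiv ℝ (gradient f) x

/-- If the derivative of `G` along the ray `x - t • v` moves away from its initial value at rate at
most `C`, then the first-order Taylor remainder of `G` at `x - s • v` is at most `C / 2 * s ^ 2`. -/
theorem norm_taylor_remainder_ray_le {E F : Type*} [NormedAddCommGroup E] [NormedSpace ℝ E]
    [NormedAddCommGroup F] [NormedSpace ℝ F] {G : E → F} (hG : Differentiable ℝ G)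
    {x v : E} {C : ℝ}
    (h : ∀ t : ℝ, 0 ≤ t → ‖(fderiv ℝ G (x - t • v) - fderiv ℝ G x) v‖ ≤ C * t)
    {s : ℝ} (hs : 0 ≤ s) :
    ‖G (x - s • v) - (G x - s • fderiv ℝ G x v)‖ ≤ C / 2 * s ^ 2 := by
  have hderiv (t : ℝ) : HasDerivAt (fun t : ℝ => G (x - t • v) - (G x - t • fderiv ℝ G x v))
      (-((fderiv ℝ G (x - t • v) - fderiv ℝ G x) v)) t := by
    have h₁ : HasDerivAt (fun t : ℝ => x - t • v) (-v) t := by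
      simpa using ((hasDerivAt_id t).smul_const v).const_sub x
    have h₂ : HasDerivAt (fun t : ℝ => G x - t • fderiv ℝ G x v) (-(fderiv ℝ G x v)) t := by
      simpa using ((hasDerivAt_id t).smul_const (fderiv ℝ G x v)).const_sub (G x)
    refine (((hG (x - t • v)).hasFDerivAt.comp_hasDerivAt t h₁).sub h₂).congr_deriv ?_
    rw [map_neg, sub_apply]
    abel
  have hbound (t : ℝ) : HasDerivAt (fun t : ℝ => C / 2 * t ^ 2) (C * t) t := by
    refine ((hasDerivAt_pow 2 t).const_mul (C / 2)).congr_deriv ?_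
    norm_num
    ring
  refine image_norm_le_of_norm_deriv_right_le_deriv_boundary
    (fun t _ => (hderiv t).continuousAt.continuousWithinAt)
    (fun t _ => (hderiv t).hasDerivWithinAt) (by simp) hbound (fun t ht => ?_)
    (Set.right_mem_Icc.2 hs)
  rw [norm_neg]
  exact h t ht.1

/-- The distance from `v` to its projection onto the line spanned by `w`, in terms of the cosine
of the angle between `v` and `w`. -/
theorem norm_sub_inner_div_smul_eq {E : Type*} [NormedAddCommGroup E] [InnerProductSpace ℝ E]
    {v w : E} (hv : v ≠ 0) (hw : w ≠ 0) :
    ‖v - (⟪v, w⟫ / ‖w‖ ^ 2) • w‖ = √(1 - (⟪v, w⟫ / (‖v‖ * ‖w‖)) ^ 2) * ‖v‖ := by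
  have hv' := norm_ne_zero_iff.2 hv
  have hw' := norm_ne_zero_iff.2 hw
  have hsq : ‖v - (⟪v, w⟫ / ‖w‖ ^ 2) • w‖ ^ 2
      = (1 - (⟪v, w⟫ / (‖v‖ * ‖w‖)) ^ 2) * ‖v‖ ^ 2 := by
    rw [norm_sub_sq_real, inner_smul_right, norm_smul, mul_pow, Real.norm_eq_abs, sq_abs]
    field_simp
    ring
  rw [← Real.sqrt_sq (norm_nonneg (v - _)), hsq, Real.sqrt_mul' _ (sq_nonneg _),
    Real.sqrt_sq (norm_nonneg v)]

theorem ContDiff.differentiable_gradient {E : Type*} [NormedAddCommGroup E]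
    [InnerProductSpace ℝ E] [CompleteSpace E] {f : E → ℝ} (hf : ContDiff ℝ 2 f) :
    Differentiable ℝ (gradient f) :=
  (InnerProductSpace.toDual ℝ E).symm.differentiable.comp
    ((hf.fderiv_right (m := 1) (by norm_num)).differentiable (by norm_num))

/-- Gradient norm recursion for the MR scaling. -/
theorem stmt_16 {d : ℕ} (f : EuclideanSpace ℝ (Fin d) → ℝ) (hf : ContDiff ℝ 2 f)
    (L₂ : ℝ) (hL₂ : 0 ≤ L₂)
    (hsmooth : ∀ x : EuclideanSpace ℝ (Fin d), ∀ t : ℝ, 0 ≤ t →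
      ‖hessian f (x - t • gradient f x) - hessian f x‖ ≤ t * L₂ * ‖gradient f x‖)
    (x : EuclideanSpace ℝ (Fin d)) (hgx : gradient f x ≠ 0)
    (hHg : hessian f x (gradient f x) ≠ 0)
    (s : ℝ)
    (hs : s = ⟪gradient f x, hessian f x (gradient f x)⟫ /
      ‖hessian f x (gradient f x)‖ ^ 2)
    (hs0 : 0 ≤ s)
    (p : EuclideanSpace ℝ (Fin d)) (hp : p = -(s • gradient f x)) :
    ‖gradient f (x + p)‖ ≤ L₂ / 2 * ‖p‖ ^ 2 +
      Real.sqrt (1 - (⟪gradient f x, hessian f x (gradient f x)⟫ /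
        (‖gradient f x‖ * ‖hessian f x (gradient f x)‖)) ^ 2) * ‖gradient f x‖ := by
  have hrem := norm_taylor_remainder_ray_le hf.differentiable_gradient
    (x := x) (v := gradient f x) (C := L₂ * ‖gradient f x‖ ^ 2) (fun t ht => by
      calc
        _ ≤ t * L₂ * ‖gradient f x‖ * ‖gradient f x‖ :=
          ContinuousLinearMap.le_of_opNorm_le _ (hsmooth x t ht) _
        _ = L₂ * ‖gradient f x‖ ^ 2 * t := by ring) hs0
  have hproj := norm_sub_inner_div_smul_eq hgx hHg
  rw [← hs] at hproj
  rw [← hproj, hp, ← sub_eq_add_neg]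
  calc
    _ ≤ _ := norm_le_norm_sub_add _ (gradient f x - s • hessian f x (gradient f x))
    _ ≤ L₂ * ‖gradient f x‖ ^ 2 / 2 * s ^ 2 + _ := by gcongr; exact hrem
    _ = _ := by
      rw [norm_neg, norm_smul, mul_pow, Real.norm_eq_abs, sq_abs]
      ring
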